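/- arXiv:2511.10889 — 2 statements merged into one kernel-verified Lean document; each statement's English description precedes it below -/
import Mathlib

section
/- The graphs T_0 and T_1 are anticonnected, contain no simplicial vertices and no universal vertices, and are (2P_3,C_4,C_6,C_7)-free; consequently, any thickening of T_0 or of T_1 is anticonnected, contains no simplicial vertices and no universal vertices, and is (2P_3,C_4,C_6,C_7)-free. -/
open SimpleGraph

namespace Paper2P3

variable {V : Type*}

/-- `G` contains an induced subgraph isomorphic to `H`. -/
def ContainsInduced {V W : Type*} (G : SimpleGraph V) (H : SimpleGraph W) : Prop :=
  ∃ s : Set V, Nonempty (H ≃g G.induce s)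

/-- `G` is `H`-free: no induced subgraph of `G` is isomorphic to `H`. -/
def HFree {V W : Type*} (G : SimpleGraph V) (H : SimpleGraph W) : Prop :=
  ¬ ContainsInduced G H

/-- `S` is complete to `T` in `G`. -/
def Complete (G : SimpleGraph V) (S T : Set V) : Prop :=
  ∀ a ∈ S, ∀ b ∈ T, G.Adj a b

/-- `S` is anticomplete to `T` in `G`. -/
def Anticomplete (G : SimpleGraph V) (S T : Set V) : Prop :=
  ∀ a ∈ S, ∀ b ∈ T, ¬ G.Adj a b

/-- The closed neighborhood `N_G[v]`. -/
def closedNbhd (G : SimpleGraph V) (v : V) : Set V := insert v (G.neighborSet v)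

/-- A simplicial vertex: its neighborhood is a clique. -/
def IsSimplicial (G : SimpleGraph V) (v : V) : Prop := G.IsClique (G.neighborSet v)

/-- A universal vertex: adjacent to all other vertices. -/
def IsUniversalVertex (G : SimpleGraph V) (v : V) : Prop := ∀ w, w ≠ v → G.Adj v w

/-- `G` admits a clique-cutset: a clique `C ⊊ V(G)` such that `G - C` is disconnected. -/
def HasCliqueCutset (G : SimpleGraph V) : Prop :=
  ∃ C : Set V, G.IsClique C ∧ C ≠ Set.univ ∧ ¬ (G.induce Cᶜ).Connected

/-- The disjoint union of two copies of `P_3`, on vertices `0,1,2` and `3,4,5`. -/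
def twoP3 : SimpleGraph (Fin 6) :=
  SimpleGraph.fromRel fun a b => (a, b) ∈ ([(0,1),(1,2),(3,4),(4,5)] : List (Fin 6 × Fin 6))

/-- The edgeless graph on four vertices. -/
def fourK1 : SimpleGraph (Fin 4) := ⊥

/-- `Gs` is a thickening of `G`. -/
def IsThickening {α β : Type*} (Gs : SimpleGraph β) (G : SimpleGraph α) : Prop :=
  ∃ X : α → Set β,
    (∀ v, (X v).Nonempty) ∧
    (∀ u v : α, u ≠ v → Disjoint (X u) (X v)) ∧
    (⋃ v, X v) = Set.univ ∧
    (∀ v, Gs.IsClique (X v)) ∧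
    (∀ u v : α, u ≠ v →
      (G.Adj u v → Complete Gs (X u) (X v)) ∧ (¬ G.Adj u v → Anticomplete Gs (X u) (X v)))

/-- The closed neighborhoods of the vertices of `S` form a chain under inclusion;
equivalently (for finite graphs), `S` can be ordered as `a_1, …, a_r` with
`N_G[a_r] ⊆ ⋯ ⊆ N_G[a_1]`. -/
def ChainClosedNbhd (G : SimpleGraph V) (S : Set V) : Prop :=
  ∀ a ∈ S, ∀ b ∈ S, closedNbhd G a ⊆ closedNbhd G b ∨ closedNbhd G b ⊆ closedNbhd G a

/-- `A` can be partitioned into cliques, pairwise anticomplete to each other. -/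
def CliquesPartition (G : SimpleGraph V) (A : Set V) : Prop :=
  ∃ (ℓ : ℕ) (P : Fin ℓ → Set V),
    (∀ i, G.IsClique (P i)) ∧
    (∀ i j, i ≠ j → Disjoint (P i) (P j)) ∧
    (∀ i j, i ≠ j → Anticomplete G (P i) (P j)) ∧
    (⋃ i, P i) = A

/-- `A` can be partitioned into nonempty cliques, pairwise anticomplete to each other. -/
def NonemptyCliquesPartition (G : SimpleGraph V) (A : Set V) : Prop :=
  ∃ (ℓ : ℕ) (P : Fin ℓ → Set V),
    (∀ i, (P i).Nonempty) ∧
    (∀ i, G.IsClique (P i)) ∧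
    (∀ i j, i ≠ j → Disjoint (P i) (P j)) ∧
    (∀ i j, i ≠ j → Anticomplete G (P i) (P j)) ∧
    (⋃ i, P i) = A

/-- `A` can be partitioned into nonempty cliques, pairwise anticomplete to each other,
each of which can be ordered so that the closed neighborhoods form a decreasing chain. -/
def OrderedCliquesPartition (G : SimpleGraph V) (A : Set V) : Prop :=
  ∃ (ℓ : ℕ) (P : Fin ℓ → Set V),
    (∀ i, (P i).Nonempty) ∧
    (∀ i, G.IsClique (P i)) ∧
    (∀ i j, i ≠ j → Disjoint (P i) (P j)) ∧
    (∀ i j, i ≠ j → Anticomplete G (P i) (P j)) ∧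
    (⋃ i, P i) = A ∧
    (∀ i, ChainClosedNbhd G (P i))

/-- `(X_0,…,X_6; Y_0,…,Y_6; Z_0,…,Z_6; W)` is a special partition of the induced
subgraph of `G` on `S` (indices in `ℤ_7`). -/
def IsSpecialPartitionOn (G : SimpleGraph V) (S : Set V)
    (X Y Z : ZMod 7 → Set V) (W : Set V) : Prop :=
  -- the sets are pairwise disjoint and their union is `S`
  (∀ i j, i ≠ j → Disjoint (X i) (X j)) ∧
  (∀ i j, i ≠ j → Disjoint (Y i) (Y j)) ∧
  (∀ i j, i ≠ j → Disjoint (Z i) (Z j)) ∧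
  (∀ i j, Disjoint (X i) (Y j)) ∧
  (∀ i j, Disjoint (X i) (Z j)) ∧
  (∀ i j, Disjoint (Y i) (Z j)) ∧
  (∀ i, Disjoint (X i) W) ∧ (∀ i, Disjoint (Y i) W) ∧ (∀ i, Disjoint (Z i) W) ∧
  ((⋃ i, X i) ∪ (⋃ i, Y i) ∪ (⋃ i, Z i) ∪ W = S) ∧
  -- all the sets are cliques
  (∀ i, G.IsClique (X i)) ∧ (∀ i, G.IsClique (Y i)) ∧ (∀ i, G.IsClique (Z i)) ∧
  G.IsClique W ∧
  -- (a)
  (∀ i, (X i).Nonempty) ∧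
  -- (b)
  (∀ i, Complete G (X i) (X (i - 1)) ∧ Complete G (X i) (X (i + 1)) ∧
    Anticomplete G (X i) (X (i + 2)) ∧ Anticomplete G (X i) (X (i + 3)) ∧
    Anticomplete G (X i) (X (i + 4)) ∧ Anticomplete G (X i) (X (i + 5))) ∧
  -- (c)
  (∀ i, Complete G (X i) (Y i) ∧ Complete G (X i) (Y (i + 3)) ∧
    Complete G (X i) (Y (i + 6)) ∧ Complete G (X i) (Z i) ∧
    Complete G (X i) (Z (i + 3)) ∧ Complete G (X i) (Z (i + 4)) ∧
    Complete G (X i) (Z (i + 5)) ∧ Complete G (X i) (Z (i + 6)) ∧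
    Complete G (X i) W ∧
    Anticomplete G (X i) (Y (i + 1)) ∧ Anticomplete G (X i) (Y (i + 2)) ∧
    Anticomplete G (X i) (Y (i + 4)) ∧ Anticomplete G (X i) (Y (i + 5)) ∧
    Anticomplete G (X i) (Z (i + 1)) ∧ Anticomplete G (X i) (Z (i + 2))) ∧
  -- (d)
  (∀ i, (Y i).Nonempty →
    (Y (i + 1) = ∅ ∧ Y (i + 2) = ∅ ∧ Y (i + 5) = ∅ ∧ Y (i + 6) = ∅ ∧
      Z (i + 5) = ∅ ∧ Z (i + 6) = ∅) ∧ (Y (i + 3) = ∅ ∨ Y (i + 4) = ∅)) ∧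
  -- (e)
  (∀ i, (Z i).Nonempty → Z (i + 2) = ∅ ∧ Z (i + 5) = ∅) ∧
  -- (f)
  (∀ i, Complete G (Y i) (Y (i + 3)) ∧ Complete G (Y i) (Y (i + 4)) ∧
    Complete G (Y i) (Z i) ∧ Complete G (Y i) (Z (i + 1)) ∧
    Complete G (Y i) (Z (i + 3)) ∧ Complete G (Y i) (Z (i + 4)) ∧
    Complete G (Y i) W ∧ Anticomplete G (Y i) (Z (i + 2))) ∧
  -- (g)
  (∀ i, Complete G (Z i) (Z (i + 1)) ∧ Complete G (Z i) (Z (i + 3)) ∧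
    Complete G (Z i) (Z (i + 4)) ∧ Complete G (Z i) (Z (i + 6)) ∧ Complete G (Z i) W)

/-- `G` admits a special partition. -/
def AdmitsSpecialPartition (G : SimpleGraph V) : Prop :=
  ∃ (X Y Z : ZMod 7 → Set V) (W : Set V), IsSpecialPartitionOn G Set.univ X Y Z W

/-- `G` is a 7-saucer. -/
def IsSevenSaucer (G : SimpleGraph V) : Prop :=
  ∃ (X Y Z : ZMod 7 → Set V) (W A : Set V),
    IsSpecialPartitionOn G Aᶜ X Y Z W ∧
    (∀ i, Anticomplete G A (X i)) ∧
    (∀ i, Anticomplete G A (Y i) ∨ Z (i + 2) = ∅) ∧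
    (A = ∅ ∨ OrderedCliquesPartition G A)
/-- The graph `M_0`: vertices `0,…,6` are `x_0,…,x_6` (a 7-cycle), `7 = y_0`,
`8 = y_3`, `9 = z_0`, `10 = z_3`, `11 = z_4`. -/
def M0 : SimpleGraph (Fin 12) :=
  SimpleGraph.fromRel fun a b => (a, b) ∈
    ([(0,1),(1,2),(2,3),(3,4),(4,5),(5,6),(6,0),
      (7,0),(7,1),(7,4),
      (8,3),(8,4),(8,0),
      (9,0),(9,1),(9,2),(9,3),(9,4),
      (10,3),(10,4),(10,5),(10,6),(10,0),
      (11,4),(11,5),(11,6),(11,0),(11,1),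
      (7,8),(7,9),(7,10),(7,11),(8,9),(8,10),(8,11),(9,10),(9,11),(10,11)] :
      List (Fin 12 × Fin 12))

/-- The graph `M_1`: vertices `0,…,6` are `x_0,…,x_6` (a 7-cycle), `7 = y_0`, `8 = z_2`. -/
def M1 : SimpleGraph (Fin 9) :=
  SimpleGraph.fromRel fun a b => (a, b) ∈
    ([(0,1),(1,2),(2,3),(3,4),(4,5),(5,6),(6,0),
      (7,0),(7,1),(7,4),
      (8,2),(8,3),(8,4),(8,5),(8,6)] : List (Fin 9 × Fin 9))

/-- The graph `M_2`: `M_1` plus the vertex `9 = z_1`. -/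
def M2 : SimpleGraph (Fin 10) :=
  SimpleGraph.fromRel fun a b => (a, b) ∈
    ([(0,1),(1,2),(2,3),(3,4),(4,5),(5,6),(6,0),
      (7,0),(7,1),(7,4),
      (8,2),(8,3),(8,4),(8,5),(8,6),
      (9,1),(9,2),(9,3),(9,4),(9,5),(9,7),(9,8)] : List (Fin 10 × Fin 10))

/-- The graph `M_3`: `M_1` plus the vertex `9 = z_3`. -/
def M3 : SimpleGraph (Fin 10) :=
  SimpleGraph.fromRel fun a b => (a, b) ∈
    ([(0,1),(1,2),(2,3),(3,4),(4,5),(5,6),(6,0),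
      (7,0),(7,1),(7,4),
      (8,2),(8,3),(8,4),(8,5),(8,6),
      (9,3),(9,4),(9,5),(9,6),(9,0),(9,7),(9,8)] : List (Fin 10 × Fin 10))

/-- The set `{y_0, y_3, z_0, z_3, z_4}` of vertices of `M_0`. -/
def M0Extra : Set (Fin 12) := {7, 8, 9, 10, 11}

/-- `H` is a thickening of a graph in the family `ℳ`, which consists of
`M_1`, `M_2`, `M_3`, and all graphs `M_0 - S` for `S ⊆ {y_0,y_3,z_0,z_3,z_4}`. -/
def IsThickeningOfM {β : Type*} (H : SimpleGraph β) : Prop :=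
  IsThickening H M1 ∨ IsThickening H M2 ∨ IsThickening H M3 ∨
  ∃ S : Set (Fin 12), S ⊆ M0Extra ∧ IsThickening H (M0.induce Sᶜ)
/-- The graph `T_0`: vertices `0 = a_0`, `1 = a_1`, `2 = b_0`, `3 = b_1`, `4 = b_2`,
`5 = b_3`, `6 = c_1`, `7 = c_2`, `8 = c_3`. -/
def T0 : SimpleGraph (Fin 9) :=
  SimpleGraph.fromRel fun a b => (a, b) ∈
    ([(0,1),(0,2),(0,4),(0,5),(1,3),(1,4),(1,5),
      (2,6),(3,6),(4,7),(5,8),(6,7),(6,8),(7,8)] : List (Fin 9 × Fin 9))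

/-- The graph `T_1`: `T_0` plus the vertex `9 = f_3`, adjacent to
`a_0,a_1,b_0,b_1,b_2,c_1,c_2` and nonadjacent to `b_3,c_3`. -/
def T1 : SimpleGraph (Fin 10) :=
  SimpleGraph.fromRel fun a b => (a, b) ∈
    ([(0,1),(0,2),(0,4),(0,5),(1,3),(1,4),(1,5),
      (2,6),(3,6),(4,7),(5,8),(6,7),(6,8),(7,8),
      (9,0),(9,1),(9,2),(9,3),(9,4),(9,6),(9,7)] : List (Fin 10 × Fin 10))
/-- `(A_0,A_1;B_0,B_1,B_2,B_3;C_1,C_2,C_3;F_2,F_3;W;Y;Z)` is a tent partition of `G`. -/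
def IsTentPartition (G : SimpleGraph V)
    (A0 A1 B0 B1 B2 B3 C1 C2 C3 F2 F3 W Y Z : Set V) : Prop :=
  let P : Fin 14 → Set V := ![A0, A1, B0, B1, B2, B3, C1, C2, C3, F2, F3, W, Y, Z]
  -- the fourteen sets form a partition of the vertex set
  (∀ i j : Fin 14, i ≠ j → Disjoint (P i) (P j)) ∧
  (⋃ i, P i) = Set.univ ∧
  -- A_0,A_1,B_0,B_1,B_2,B_3,C_1,C_2,C_3 are nonempty cliques
  (A0.Nonempty ∧ A1.Nonempty ∧ B0.Nonempty ∧ B1.Nonempty ∧ B2.Nonempty ∧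
    B3.Nonempty ∧ C1.Nonempty ∧ C2.Nonempty ∧ C3.Nonempty) ∧
  (G.IsClique A0 ∧ G.IsClique A1 ∧ G.IsClique B0 ∧ G.IsClique B1 ∧ G.IsClique B2 ∧
    G.IsClique B3 ∧ G.IsClique C1 ∧ G.IsClique C2 ∧ G.IsClique C3) ∧
  -- F_2, F_3, Y are cliques, and at most one of them is nonempty
  (G.IsClique F2 ∧ G.IsClique F3 ∧ G.IsClique Y) ∧
  ((F2 = ∅ ∧ F3 = ∅) ∨ (F2 = ∅ ∧ Y = ∅) ∨ (F3 = ∅ ∧ Y = ∅)) ∧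
  -- W is a (possibly empty) clique
  G.IsClique W ∧
  Complete G A0 A1 ∧
  (Complete G A0 B0 ∧ Complete G A0 B2 ∧ Complete G A0 B3 ∧
    Anticomplete G A0 B1 ∧ Anticomplete G A0 C1 ∧ Anticomplete G A0 C2 ∧
    Anticomplete G A0 C3) ∧
  (Complete G A1 B1 ∧ Complete G A1 B2 ∧ Complete G A1 B3 ∧
    Anticomplete G A1 B0 ∧ Anticomplete G A1 C1 ∧ Anticomplete G A1 C2 ∧
    Anticomplete G A1 C3) ∧
  (Anticomplete G B0 B1 ∧ Anticomplete G B0 B2 ∧ Anticomplete G B0 B3 ∧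
    Anticomplete G B1 B2 ∧ Anticomplete G B1 B3 ∧ Anticomplete G B2 B3) ∧
  (Complete G C1 C2 ∧ Complete G C1 C3 ∧ Complete G C2 C3) ∧
  (Complete G C1 B0 ∧ Complete G C1 B1 ∧ Anticomplete G C1 B2 ∧ Anticomplete G C1 B3) ∧
  (Complete G C2 B2 ∧ Anticomplete G C2 B0 ∧ Anticomplete G C2 B1 ∧
    Anticomplete G C2 B3) ∧
  (Complete G C3 B3 ∧ Anticomplete G C3 B0 ∧ Anticomplete G C3 B1 ∧
    Anticomplete G C3 B2) ∧
  (Complete G F2 A0 ∧ Complete G F2 A1 ∧ Complete G F2 B0 ∧ Complete G F2 B1 ∧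
    Complete G F2 B3 ∧ Complete G F2 C1 ∧ Complete G F2 C3 ∧
    Anticomplete G F2 B2 ∧ Anticomplete G F2 C2) ∧
  (Complete G F3 A0 ∧ Complete G F3 A1 ∧ Complete G F3 B0 ∧ Complete G F3 B1 ∧
    Complete G F3 B2 ∧ Complete G F3 C1 ∧ Complete G F3 C2 ∧
    Anticomplete G F3 B3 ∧ Anticomplete G F3 C3) ∧
  (Complete G W A0 ∧ Complete G W A1 ∧ Complete G W B0 ∧ Complete G W B1 ∧
    Complete G W B2 ∧ Complete G W B3 ∧ Complete G W C1 ∧ Complete G W C2 ∧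
    Complete G W C3 ∧ Complete G W F2 ∧ Complete G W F3) ∧
  (Complete G Y C2 ∧ Complete G Y C3 ∧
    Anticomplete G Y A0 ∧ Anticomplete G Y A1 ∧ Anticomplete G Y B0 ∧
    Anticomplete G Y B1 ∧ Anticomplete G Y B2 ∧ Anticomplete G Y B3 ∧
    Anticomplete G Y C1) ∧
  (Anticomplete G Z A0 ∧ Anticomplete G Z A1 ∧ Anticomplete G Z B0 ∧
    Anticomplete G Z B1 ∧ Anticomplete G Z B2 ∧ Anticomplete G Z B3 ∧
    Anticomplete G Z C1 ∧ Anticomplete G Z C2 ∧ Anticomplete G Z C3 ∧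
    Anticomplete G Z Y) ∧
  -- Y can be ordered so that the closed neighborhoods form a chain
  ChainClosedNbhd G Y ∧
  -- Z is empty or can be partitioned into nonempty cliques, pairwise anticomplete,
  -- each ordered so that the closed neighborhoods form a chain
  (Z = ∅ ∨ OrderedCliquesPartition G Z)

/-- `G` is a tent. -/
def IsTent (G : SimpleGraph V) : Prop :=
  ∃ A0 A1 B0 B1 B2 B3 C1 C2 C3 F2 F3 W Y Z : Set V,
    IsTentPartition G A0 A1 B0 B1 B2 B3 C1 C2 C3 F2 F3 W Y Z

/-- `G` is anticonnected, has neither simplicial nor universal vertices, and is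
`(2P_3,C_4,C_6,C_7)`-free. -/
def IsAnticonnectedFree (G : SimpleGraph V) : Prop :=
  Gᶜ.Connected ∧ (∀ v, ¬ IsSimplicial G v) ∧ (∀ v, ¬ IsUniversalVertex G v) ∧
    HFree G twoP3 ∧ HFree G (cycleGraph 4) ∧ HFree G (cycleGraph 6) ∧ HFree G (cycleGraph 7)

/-- Any two adjacent vertices of `G` are distinguished by a third vertex. -/
def TrueTwinFree (G : SimpleGraph V) : Prop :=
  ∀ i j, G.Adj i j → ∃ k, k ≠ i ∧ k ≠ j ∧ ¬ (G.Adj i k ↔ G.Adj j k)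

theorem containsInduced_iff_nonempty_embedding {W : Type*} {G : SimpleGraph V}
    {H : SimpleGraph W} : ContainsInduced G H ↔ Nonempty (H ↪g G) := by
  constructor
  · rintro ⟨s, ⟨e⟩⟩
    exact ⟨e.toEmbedding.trans (Embedding.induce s)⟩
  · rintro ⟨f⟩
    refine ⟨Set.range f, ⟨⟨Equiv.ofInjective f f.injective, ?_⟩⟩⟩
    intro a b
    exact f.map_adj_iff

theorem hFree_iff_isEmpty_embedding {W : Type*} {G : SimpleGraph V} {H : SimpleGraph W} :
    HFree G H ↔ IsEmpty (H ↪g G) := by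
  rw [HFree, containsInduced_iff_nonempty_embedding, not_nonempty_iff]

section Thickening

variable {α β W : Type*} {G : SimpleGraph α} {Gs : SimpleGraph β}

/-- A thickening of `G` projects onto `G`, sending each vertex to the index of its clique. -/
theorem IsThickening.exists_projection (h : IsThickening Gs G) :
    ∃ p : β → α, Function.Surjective p ∧
      ∀ x y, Gs.Adj x y ↔ x ≠ y ∧ (p x = p y ∨ G.Adj (p x) (p y)) := by
  obtain ⟨X, hne, hdis, hcov, hcl, hadj⟩ := h
  have hmem : ∀ x, ∃ v, x ∈ X v := fun x => by
    simpa using (hcov ▸ Set.mem_univ x : x ∈ ⋃ v, X v)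
  choose p hp using hmem
  refine ⟨p, fun v => ?_, fun x y => ?_⟩
  · obtain ⟨x, hx⟩ := hne v
    refine ⟨x, ?_⟩
    by_contra hxv
    exact Set.disjoint_left.mp (hdis _ _ hxv) (hp x) hx
  · by_cases hxy : p x = p y
    · have hy : y ∈ X (p x) := hxy ▸ hp y
      exact ⟨fun h => ⟨h.ne, Or.inl hxy⟩, fun h => hcl (p x) (hp x) hy h.1⟩
    · refine ⟨fun h => ⟨h.ne, Or.inr ?_⟩, fun h => ?_⟩
      · by_contra hn
        exact (hadj _ _ hxy).2 hn x (hp x) y (hp y) h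
      · exact (hadj _ _ hxy).1 (h.2.resolve_left hxy) x (hp x) y (hp y)

/-- Excluding an induced subgraph without true twins is inherited by thickenings. -/
theorem HFree.thickening {H : SimpleGraph W} (hH : TrueTwinFree H) (hG : HFree G H)
    (h : IsThickening Gs G) : HFree Gs H := by
  obtain ⟨p, -, hp⟩ := h.exists_projection
  rw [hFree_iff_isEmpty_embedding] at hG ⊢
  refine ⟨fun f => hG.elim ?_⟩
  have hf : ∀ i j, H.Adj i j ↔ i ≠ j ∧ (p (f i) = p (f j) ∨ G.Adj (p (f i)) (p (f j))) := by
    intro i j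
    rw [← f.map_adj_iff, hp, f.injective.ne_iff]
  have hinj : Function.Injective (p ∘ f) := by
    intro i j hij
    simp only [Function.comp_apply] at hij
    by_contra hne
    obtain ⟨k, hki, hkj, hk⟩ := hH i j ((hf i j).2 ⟨hne, Or.inl hij⟩)
    apply hk
    rw [hf, hf, hij]
    simp [hki.symm, hkj.symm]
  refine ⟨⟨p ∘ f, hinj⟩, ?_⟩
  intro i j
  change G.Adj (p (f i)) (p (f j)) ↔ H.Adj i j
  rw [hf]
  refine ⟨fun h => ⟨fun hij => ?_, Or.inr h⟩, fun h => h.2.resolve_left (hinj.ne h.1)⟩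
  exact h.ne (by rw [hij])

theorem not_isSimplicial_thickening (hG : ∀ v, ¬ IsSimplicial G v) (h : IsThickening Gs G)
    (x : β) : ¬ IsSimplicial Gs x := by
  obtain ⟨p, hsurj, hp⟩ := h.exists_projection
  intro hx
  refine hG (p x) fun u hu v hv huv => ?_
  obtain ⟨y, rfl⟩ := hsurj u
  obtain ⟨z, rfl⟩ := hsurj v
  have hy : Gs.Adj x y := (hp x y).2 ⟨fun e => hu.ne (by rw [e]), Or.inr hu⟩
  have hz : Gs.Adj x z := (hp x z).2 ⟨fun e => hv.ne (by rw [e]), Or.inr hv⟩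
  exact ((hp y z).1 (hx hy hz fun e => huv (by rw [e]))).2.resolve_left huv

theorem not_isUniversalVertex_thickening (hG : ∀ v, ¬ IsUniversalVertex G v)
    (h : IsThickening Gs G) (x : β) : ¬ IsUniversalVertex Gs x := by
  obtain ⟨p, hsurj, hp⟩ := h.exists_projection
  intro hx
  refine hG (p x) fun u hu => ?_
  obtain ⟨y, rfl⟩ := hsurj u
  exact ((hp x y).1 (hx y fun e => hu (by rw [e]))).2.resolve_left (Ne.symm hu)

theorem connected_compl_thickening (hG : ∀ v, ¬ IsUniversalVertex G v) (hc : Gᶜ.Connected)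
    (h : IsThickening Gs G) : Gsᶜ.Connected := by
  obtain ⟨p, hsurj, hp⟩ := h.exists_projection
  have hcompl : ∀ x y, Gᶜ.Adj (p x) (p y) → Gsᶜ.Adj x y := by
    intro x y hxy
    rw [compl_adj] at hxy ⊢
    refine ⟨fun e => hxy.1 (by rw [e]), fun hadj => ?_⟩
    exact ((hp x y).1 hadj).2.elim hxy.1 hxy.2
  choose s hs using hsurj
  let φ : Gᶜ →g Gsᶜ := ⟨s, fun {u v} huv => hcompl _ _ (by rwa [hs, hs])⟩
  have hsection : ∀ x, Gsᶜ.Reachable x (s (p x)) := by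
    intro x
    have hx := hG (p x)
    unfold IsUniversalVertex at hx
    push Not at hx
    obtain ⟨w, hw, hxw⟩ := hx
    have hadj : Gᶜ.Adj (p x) w := (compl_adj _ _ _).2 ⟨hw.symm, hxw⟩
    exact (hcompl x (s w) (by rwa [hs])).reachable.trans (φ.map_adj hadj.symm).reachable
  have : Nonempty β := hc.nonempty.map s
  refine ⟨fun x y => ?_⟩
  exact (hsection x).trans (((hc.preconnected (p x) (p y)).map φ).trans (hsection y).symm)

end Thickening

instance : DecidableRel twoP3.Adj := by
  unfold twoP3
  infer_instance

theorem twoP3_trueTwinFree : TrueTwinFree twoP3 := by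
  unfold TrueTwinFree
  decide

theorem cycleGraph_four_trueTwinFree : TrueTwinFree (cycleGraph 4) := by
  unfold TrueTwinFree
  decide

theorem cycleGraph_six_trueTwinFree : TrueTwinFree (cycleGraph 6) := by
  unfold TrueTwinFree
  decide

theorem cycleGraph_seven_trueTwinFree : TrueTwinFree (cycleGraph 7) := by
  unfold TrueTwinFree
  decide

theorem IsAnticonnectedFree.thickening {α β : Type*} {G : SimpleGraph α} {Gs : SimpleGraph β}
    (hG : IsAnticonnectedFree G) (h : IsThickening Gs G) : IsAnticonnectedFree Gs := by
  obtain ⟨hc, hs, hu, h2, h4, h6, h7⟩ := hG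
  exact ⟨connected_compl_thickening hu hc h, not_isSimplicial_thickening hs h,
    not_isUniversalVertex_thickening hu h, h2.thickening twoP3_trueTwinFree h,
    h4.thickening cycleGraph_four_trueTwinFree h, h6.thickening cycleGraph_six_trueTwinFree h,
    h7.thickening cycleGraph_seven_trueTwinFree h⟩

section Search

variable {G : SimpleGraph V}

theorem hFree_twoP3_of_forall
    (h : ∀ a b, G.Adj a b → ∀ c, G.Adj b c → a ≠ c → ¬ G.Adj a c →
      ∀ d, ¬ G.Adj a d → ¬ G.Adj b d → ¬ G.Adj c d →
      ∀ e, G.Adj d e → ¬ G.Adj a e → ¬ G.Adj b e → ¬ G.Adj c e →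
      ∀ f, G.Adj e f → d ≠ f → ¬ G.Adj d f → ¬ G.Adj a f → ¬ G.Adj b f → G.Adj c f) :
    HFree G twoP3 := by
  rw [hFree_iff_isEmpty_embedding]
  refine ⟨fun g => ?_⟩
  have adj : ∀ i j, twoP3.Adj i j → G.Adj (g i) (g j) := fun i j => g.map_adj_iff.2
  have nadj : ∀ i j, ¬ twoP3.Adj i j → ¬ G.Adj (g i) (g j) := fun i j => mt g.map_adj_iff.1
  have ne : ∀ i j, i ≠ j → g i ≠ g j := fun i j => g.injective.ne
  refine nadj 2 5 (by decide) (h (g 0) (g 1) ?_ (g 2) ?_ ?_ ?_ (g 3) ?_ ?_ ?_ (g 4) ?_ ?_ ?_ ?_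
    (g 5) ?_ ?_ ?_ ?_ ?_)
  all_goals first
    | exact adj _ _ (by decide)
    | exact nadj _ _ (by decide)
    | exact ne _ _ (by decide)

theorem hFree_cycleGraph_four_of_forall
    (h : ∀ a b, G.Adj a b → ∀ c, G.Adj b c → a ≠ c → ¬ G.Adj a c →
      ∀ d, G.Adj c d → b ≠ d → ¬ G.Adj b d → ¬ G.Adj a d) :
    HFree G (cycleGraph 4) := by
  rw [hFree_iff_isEmpty_embedding]
  refine ⟨fun g => ?_⟩
  have adj : ∀ i j, (cycleGraph 4).Adj i j → G.Adj (g i) (g j) := fun i j => g.map_adj_iff.2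
  have nadj : ∀ i j, ¬ (cycleGraph 4).Adj i j → ¬ G.Adj (g i) (g j) :=
    fun i j => mt g.map_adj_iff.1
  have ne : ∀ i j, i ≠ j → g i ≠ g j := fun i j => g.injective.ne
  refine h (g 0) (g 1) ?_ (g 2) ?_ ?_ ?_ (g 3) ?_ ?_ ?_ (adj 0 3 (by decide))
  all_goals first
    | exact adj _ _ (by decide)
    | exact nadj _ _ (by decide)
    | exact ne _ _ (by decide)

theorem hFree_cycleGraph_six_of_forall
    (h : ∀ a b, G.Adj a b → ∀ c, G.Adj b c → a ≠ c → ¬ G.Adj a c →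
      ∀ d, G.Adj c d → ¬ G.Adj b d → ¬ G.Adj a d →
      ∀ e, G.Adj d e → ¬ G.Adj c e → ¬ G.Adj b e → ¬ G.Adj a e →
      ∀ f, G.Adj e f → ¬ G.Adj d f → ¬ G.Adj c f → ¬ G.Adj b f → ¬ G.Adj a f) :
    HFree G (cycleGraph 6) := by
  rw [hFree_iff_isEmpty_embedding]
  refine ⟨fun g => ?_⟩
  have adj : ∀ i j, (cycleGraph 6).Adj i j → G.Adj (g i) (g j) := fun i j => g.map_adj_iff.2
  have nadj : ∀ i j, ¬ (cycleGraph 6).Adj i j → ¬ G.Adj (g i) (g j) :=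
    fun i j => mt g.map_adj_iff.1
  refine h (g 0) (g 1) ?_ (g 2) ?_ (g.injective.ne (by decide)) ?_ (g 3) ?_ ?_ ?_ (g 4) ?_ ?_ ?_ ?_
    (g 5) ?_ ?_ ?_ ?_ (adj 0 5 (by decide))
  all_goals first
    | exact adj _ _ (by decide)
    | exact nadj _ _ (by decide)

theorem hFree_cycleGraph_seven_of_forall
    (h : ∀ a b, G.Adj a b → ∀ c, G.Adj b c → a ≠ c → ¬ G.Adj a c →
      ∀ d, G.Adj c d → ¬ G.Adj b d → ¬ G.Adj a d →
      ∀ e, G.Adj d e → ¬ G.Adj c e → ¬ G.Adj b e → ¬ G.Adj a e →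
      ∀ f, G.Adj e f → ¬ G.Adj d f → ¬ G.Adj c f → ¬ G.Adj b f → ¬ G.Adj a f →
      ∀ k, G.Adj f k → ¬ G.Adj e k → ¬ G.Adj d k → ¬ G.Adj c k → ¬ G.Adj b k → ¬ G.Adj a k) :
    HFree G (cycleGraph 7) := by
  rw [hFree_iff_isEmpty_embedding]
  refine ⟨fun g => ?_⟩
  have adj : ∀ i j, (cycleGraph 7).Adj i j → G.Adj (g i) (g j) := fun i j => g.map_adj_iff.2
  have nadj : ∀ i j, ¬ (cycleGraph 7).Adj i j → ¬ G.Adj (g i) (g j) :=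
    fun i j => mt g.map_adj_iff.1
  refine h (g 0) (g 1) ?_ (g 2) ?_ (g.injective.ne (by decide)) ?_ (g 3) ?_ ?_ ?_ (g 4) ?_ ?_ ?_ ?_
    (g 5) ?_ ?_ ?_ ?_ ?_ (g 6) ?_ ?_ ?_ ?_ ?_ (adj 0 6 (by decide))
  all_goals first
    | exact adj _ _ (by decide)
    | exact nadj _ _ (by decide)

theorem not_isSimplicial_of_forall
    (h : ∀ v, ∃ a, G.Adj v a ∧ ∃ b, G.Adj v b ∧ a ≠ b ∧ ¬ G.Adj a b) (v : V) :
    ¬ IsSimplicial G v := by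
  obtain ⟨a, ha, b, hb, hab, hn⟩ := h v
  exact fun hv => hn (hv ha hb hab)

/-- A nonempty graph in which distinct vertices are at distance at most two is connected. -/
theorem connected_of_forall_adj_or_exists [Nonempty V]
    (h : ∀ u v, u ≠ v → G.Adj u v ∨ ∃ w, G.Adj u w ∧ G.Adj w v) : G.Connected := by
  refine ⟨fun u v => ?_⟩
  by_cases huv : u = v
  · exact huv ▸ Reachable.refl u
  · obtain h | ⟨w, huw, hwv⟩ := h u v huv
    · exact h.reachable
    · exact huw.reachable.trans hwv.reachable

end Search

instance : DecidableRel T0.Adj := by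
  unfold T0
  infer_instance

instance : DecidableRel T1.Adj := by
  unfold T1
  infer_instance

set_option synthInstance.maxHeartbeats 400000 in
set_option synthInstance.maxSize 2000 in
theorem isAnticonnectedFree_T0 : IsAnticonnectedFree T0 := by
  refine ⟨connected_of_forall_adj_or_exists ?_, not_isSimplicial_of_forall ?_, ?_,
    hFree_twoP3_of_forall ?_, hFree_cycleGraph_four_of_forall ?_,
    hFree_cycleGraph_six_of_forall ?_, hFree_cycleGraph_seven_of_forall ?_⟩
  · decide +kernel
  · decide +kernel
  · unfold IsUniversalVertex
    decide +kernel
  all_goals decide +kernel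

set_option synthInstance.maxHeartbeats 400000 in
set_option synthInstance.maxSize 2000 in
theorem isAnticonnectedFree_T1 : IsAnticonnectedFree T1 := by
  refine ⟨connected_of_forall_adj_or_exists ?_, not_isSimplicial_of_forall ?_, ?_,
    hFree_twoP3_of_forall ?_, hFree_cycleGraph_four_of_forall ?_,
    hFree_cycleGraph_six_of_forall ?_, hFree_cycleGraph_seven_of_forall ?_⟩
  · decide +kernel
  · decide +kernel
  · unfold IsUniversalVertex
    decide +kernel
  all_goals decide +kernel

/-- `T_0` and `T_1` are anticonnected, contain no simplicial and no universal
vertices, and are `(2P_3,C_4,C_6,C_7)`-free; consequently, so is any thickening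
of `T_0` or of `T_1`. -/
theorem statement8 :
    ((T0ᶜ.Connected ∧ (∀ v, ¬ IsSimplicial T0 v) ∧ (∀ v, ¬ IsUniversalVertex T0 v) ∧
      HFree T0 twoP3 ∧ HFree T0 (cycleGraph 4) ∧ HFree T0 (cycleGraph 6) ∧
      HFree T0 (cycleGraph 7)) ∧
     (T1ᶜ.Connected ∧ (∀ v, ¬ IsSimplicial T1 v) ∧ (∀ v, ¬ IsUniversalVertex T1 v) ∧
      HFree T1 twoP3 ∧ HFree T1 (cycleGraph 4) ∧ HFree T1 (cycleGraph 6) ∧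
      HFree T1 (cycleGraph 7))) ∧
    (∀ (β : Type) [Fintype β] (H : SimpleGraph β), (IsThickening H T0 ∨ IsThickening H T1) →
      (Hᶜ.Connected ∧ (∀ v, ¬ IsSimplicial H v) ∧ (∀ v, ¬ IsUniversalVertex H v) ∧
        HFree H twoP3 ∧ HFree H (cycleGraph 4) ∧ HFree H (cycleGraph 6) ∧
        HFree H (cycleGraph 7))) := by
  refine ⟨⟨isAnticonnectedFree_T0, isAnticonnectedFree_T1⟩, fun β _ H hH => ?_⟩
  exact hH.elim isAnticonnectedFree_T0.thickening isAnticonnectedFree_T1.thickening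

end Paper2P3
end

section
/- Let G be a (2P_3,C_4,C_6)-free graph and let T be an induced subgraph of G isomorphic to T_0, with vertices of T labeled a_0,a_1,b_0,b_1,b_2,b_3,c_1,c_2,c_3 as in the definition of T_0. Then for every vertex x of G, one of the following holds: (a) there exists v ∈ V(T) such that N_G[x] ∩ V(T) = N_T[v]; (b) there exists i ∈ {2,3} such that N_G[x] ∩ V(T) = V(T) ∖ {b_i,c_i}; (c) N_G[x] ∩ V(T) = {c_2,c_3}; (d) N_G[x] ∩ V(T) = ∅; (e) N_G[x] ∩ V(T) = V(T). -/
open SimpleGraph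

namespace Paper2P3

variable {V : Type*}

instance inst_s9 : DecidableRel T0.Adj := by unfold T0; infer_instance

instance inst_s9_2 : DecidableRel twoP3.Adj := by unfold twoP3; infer_instance

/-- A graph containing an injective, adjacency-reflecting image of `H` is not `H`-free. -/
theorem HFree.false_of_injective {W : Type*} {G : SimpleGraph V} {H : SimpleGraph W}
    (hH : HFree G H) (f : W → V) (hf : Function.Injective f)
    (hadj : ∀ i j, G.Adj (f i) (f j) ↔ H.Adj i j) : False :=
  hH ⟨Set.range f, ⟨Equiv.ofInjective f hf, fun {i j} => hadj i j⟩⟩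

/-- The tuple `w` of vertices of `T` induces in `T` the graph `H` minus the vertex `p`. -/
def IsCopyMinus {W : Type*} {n : ℕ} (T : SimpleGraph W) (H : SimpleGraph (Fin (n + 1)))
    (p : Fin (n + 1)) (w : Fin n → W) : Prop :=
  ∀ i j, (w i = w j → i = j) ∧ (T.Adj (w i) (w j) ↔ H.Adj (p.succAbove i) (p.succAbove j))

instance {W : Type*} [DecidableEq W] {n : ℕ} (T : SimpleGraph W) [DecidableRel T.Adj]
    (H : SimpleGraph (Fin (n + 1))) [DecidableRel H.Adj] (p : Fin (n + 1)) (w : Fin n → W) :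
    Decidable (IsCopyMinus T H p w) := by
  unfold IsCopyMinus; infer_instance

/-- In an `H`-free graph, a vertex outside an induced copy of `T` does not extend a copy of
`H - p` in `T` to a copy of `H`. -/
theorem HFree.not_forall_adj_iff {W : Type*} {n : ℕ} {G : SimpleGraph V} {T : SimpleGraph W}
    {H : SimpleGraph (Fin (n + 1))} (hH : HFree G H) {t : W → V} (hinj : Function.Injective t)
    (hadj : ∀ i j, G.Adj (t i) (t j) ↔ T.Adj i j) {x : V} (hx : x ∉ Set.range t)
    {p : Fin (n + 1)} {w : Fin n → W} (hw : IsCopyMinus T H p w) :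
    ¬ ∀ i, G.Adj x (t (w i)) ↔ H.Adj p (p.succAbove i) := by
  intro hxw
  refine hH.false_of_injective (p.insertNth x (t ∘ w)) ?_ ?_
  · intro i j
    induction i using p.succAboveCases <;> induction j using p.succAboveCases <;>
      simp only [Fin.insertNth_apply_same, Fin.insertNth_apply_succAbove, Function.comp_apply]
    · exact fun _ => trivial
    · exact fun h => (hx ⟨_, h.symm⟩).elim
    · exact fun h => (hx ⟨_, h⟩).elim
    · exact fun h => congrArg _ ((hw _ _).1 (hinj h))
  · intro i j
    induction i using p.succAboveCases <;> induction j using p.succAboveCases <;>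
      simp [hxw, hadj, (hw _ _).2, G.adj_comm _ x, H.adj_comm _ p]

/-- Some induced paths of `T0` that an outside vertex can close to a `C_4`. -/
def fourCyclePaths : List (Fin 3 → Fin 9) :=
  [![0, 2, 6], ![0, 4, 7], ![1, 3, 6], ![1, 5, 8], ![2, 0, 5], ![2, 6, 3], ![2, 6, 7],
   ![3, 1, 4], ![3, 6, 7], ![4, 0, 5], ![4, 1, 5], ![4, 7, 6], ![4, 7, 8], ![5, 8, 6]]

/-- Some induced paths of `T0` that an outside vertex can close to a `C_6`. -/
def sixCyclePaths : List (Fin 5 → Fin 9) :=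
  [![0, 1, 3, 6, 7], ![0, 4, 7, 6, 3], ![1, 0, 2, 6, 8], ![1, 4, 7, 6, 2], ![2, 0, 5, 8, 7],
   ![3, 1, 4, 7, 8], ![4, 1, 3, 6, 8], ![5, 1, 3, 6, 7]]

/-- Some tuples of vertices of `T0` that an outside vertex, placed at an end of a path, can
complete to a `2P_3`. -/
def endAttachments : List (Fin 5 → Fin 9) :=
  [![0, 4, 3, 6, 8], ![0, 5, 3, 6, 7], ![1, 4, 2, 6, 8], ![1, 5, 2, 6, 7], ![2, 6, 4, 1, 5],
   ![3, 6, 4, 0, 5], ![4, 0, 3, 6, 8], ![5, 1, 2, 6, 7], ![6, 2, 4, 1, 5], ![6, 3, 4, 0, 5],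
   ![7, 8, 1, 0, 2], ![8, 7, 0, 1, 3]]

/-- Some tuples of vertices of `T0` that an outside vertex, placed at the middle of a path, can
complete to a `2P_3`. -/
def midAttachments : List (Fin 5 → Fin 9) :=
  [![2, 3, 4, 7, 8], ![2, 7, 3, 1, 5], ![2, 8, 3, 1, 4], ![3, 7, 2, 0, 5], ![3, 8, 2, 0, 4],
   ![4, 5, 2, 6, 3]]

/-- The pattern `b` completes no tuple of the four lists to the corresponding obstruction. -/
def AvoidsObstructions (b : Fin 9 → Bool) : Prop :=
  (fourCyclePaths.Forall fun w =>
    ¬ ∀ i, b (w i) = decide ((cycleGraph 4).Adj 0 (Fin.succAbove 0 i))) ∧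
  (sixCyclePaths.Forall fun w =>
    ¬ ∀ i, b (w i) = decide ((cycleGraph 6).Adj 0 (Fin.succAbove 0 i))) ∧
  (endAttachments.Forall fun w =>
    ¬ ∀ i, b (w i) = decide (twoP3.Adj 0 (Fin.succAbove 0 i))) ∧
  (midAttachments.Forall fun w =>
    ¬ ∀ i, b (w i) = decide (twoP3.Adj 1 (Fin.succAbove 1 i)))

instance : DecidablePred AvoidsObstructions := fun b => by
  unfold AvoidsObstructions; infer_instance

/-- The pattern `b` is one of the attachments to `T0` in the conclusion of the main theorem. -/
def IsStandardAttachment (b : Fin 9 → Bool) : Prop :=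
  (∃ v, ∀ i, b i = decide (i = v ∨ T0.Adj v i)) ∨
  (∀ i, b i = decide (i ≠ 4 ∧ i ≠ 7)) ∨
  (∀ i, b i = decide (i ≠ 5 ∧ i ≠ 8)) ∨
  (∀ i, b i = decide (i = 7 ∨ i = 8)) ∨
  (∀ i, b i = false) ∨
  (∀ i, b i = true)

instance : DecidablePred IsStandardAttachment := fun b => by
  unfold IsStandardAttachment; infer_instance

theorem AvoidsObstructions.isStandardAttachment {b : Fin 9 → Bool} (hb : AvoidsObstructions b) :
    IsStandardAttachment b := by
  have key : ∀ b₀ b₁ b₂ b₃ b₄ b₅ b₆ b₇ b₈ : Bool,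
      AvoidsObstructions ![b₀, b₁, b₂, b₃, b₄, b₅, b₆, b₇, b₈] →
        IsStandardAttachment ![b₀, b₁, b₂, b₃, b₄, b₅, b₆, b₇, b₈] := by
    decide +kernel
  have hbvec : ![b 0, b 1, b 2, b 3, b 4, b 5, b 6, b 7, b 8] = b := by
    ext i; fin_cases i <;> rfl
  rw [← hbvec] at hb ⊢
  exact key _ _ _ _ _ _ _ _ _ hb

/-- Attachments of a vertex to an induced copy of `T_0` in a `(2P_3,C_4,C_6)`-free
graph. In the labeling of `T_0`, vertex `4 = b_2`, `5 = b_3`, `7 = c_2`, `8 = c_3`. -/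
theorem statement9 {V : Type*} [Fintype V] (G : SimpleGraph V)
    (h2P3 : HFree G twoP3) (hC4 : HFree G (cycleGraph 4)) (hC6 : HFree G (cycleGraph 6))
    (t : Fin 9 → V) (hinj : Function.Injective t)
    (hadj : ∀ i j : Fin 9, G.Adj (t i) (t j) ↔ T0.Adj i j)
    (x : V) :
    (∃ v : Fin 9, closedNbhd G x ∩ Set.range t = t '' closedNbhd T0 v) ∨
    (closedNbhd G x ∩ Set.range t = Set.range t \ {t 4, t 7}) ∨
    (closedNbhd G x ∩ Set.range t = Set.range t \ {t 5, t 8}) ∨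
    (closedNbhd G x ∩ Set.range t = {t 7, t 8}) ∨
    (closedNbhd G x ∩ Set.range t = ∅) ∨
    (closedNbhd G x ∩ Set.range t = Set.range t) := by
  by_cases hx : x ∈ Set.range t
  · obtain ⟨v, rfl⟩ := hx
    refine Or.inl ⟨v, ?_⟩
    ext y
    constructor
    · rintro ⟨hy, i, rfl⟩
      exact ⟨i, hy.imp (fun h => hinj h) (hadj v i).1, rfl⟩
    · rintro ⟨i, hi, rfl⟩
      exact ⟨hi.imp (congrArg t) (hadj v i).2, i, rfl⟩
  classical
  have hmem (i : Fin 9) : t i ∈ closedNbhd G x ↔ G.Adj x (t i) := by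
    simp only [closedNbhd, Set.mem_insert_iff, mem_neighborSet, or_iff_right_iff_imp]
    exact fun h => (hx ⟨i, h⟩).elim
  set b : Fin 9 → Bool := fun i => decide (G.Adj x (t i)) with hb
  have himage {S : Set (Fin 9)} (h : ∀ i, b i = true ↔ i ∈ S) :
      closedNbhd G x ∩ Set.range t = t '' S := by
    rw [← Set.image_preimage_eq_inter_range]
    congr 1
    ext i
    rw [← h i, Set.mem_preimage, hmem, hb, decide_eq_true_iff]
  have hfour : fourCyclePaths.Forall (IsCopyMinus T0 (cycleGraph 4) 0) := by decide +kernel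
  have hsix : sixCyclePaths.Forall (IsCopyMinus T0 (cycleGraph 6) 0) := by decide +kernel
  have hend : endAttachments.Forall (IsCopyMinus T0 twoP3 0) := by decide +kernel
  have hmid : midAttachments.Forall (IsCopyMinus T0 twoP3 1) := by decide +kernel
  have hpair (i j : Fin 9) : Set.range t \ {t i, t j} = t '' {i, j}ᶜ := by
    rw [← Set.image_pair, ← Set.image_compl_eq_range_sdiff_image hinj]
  have hno {n : ℕ} {H : SimpleGraph (Fin (n + 1))} [DecidableRel H.Adj] (hH : HFree G H)
      {p : Fin (n + 1)} {l : List (Fin n → Fin 9)} (hl : l.Forall (IsCopyMinus T0 H p)) :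
      l.Forall fun w => ¬ ∀ i, b (w i) = decide (H.Adj p (p.succAbove i)) := by
    refine hl.imp fun _ hw => ?_
    intro h
    exact hH.not_forall_adj_iff hinj hadj hx hw fun i => decide_eq_decide.1 (h i)
  have havoid : AvoidsObstructions b :=
    ⟨hno hC4 hfour, hno hC6 hsix, hno h2P3 hend, hno h2P3 hmid⟩
  rcases havoid.isStandardAttachment with ⟨v, h⟩ | h | h | h | h | h
  · exact Or.inl ⟨v, himage fun i => by simp [h, closedNbhd]⟩
  · exact Or.inr <| Or.inl <| (himage fun i => by simp [h]).trans (hpair 4 7).symm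
  · exact Or.inr <| Or.inr <| Or.inl <| (himage fun i => by simp [h]).trans (hpair 5 8).symm
  · exact Or.inr <| Or.inr <| Or.inr <| Or.inl <|
      (himage fun i => by simp [h]).trans (Set.image_pair t 7 8)
  · exact Or.inr <| Or.inr <| Or.inr <| Or.inr <| Or.inl <|
      (himage fun i => by simp [h]).trans (Set.image_empty t)
  · exact Or.inr <| Or.inr <| Or.inr <| Or.inr <| Or.inr <|
      (himage fun i => by simp [h]).trans Set.image_univ

end Paper2P3
end
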